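/- For every nonnegative finite Borel measure m ≠ 0 on ℝ³ and every smooth compactly supported φ : ℝ³ → ℂ², one has 2π ∫_{ℝ³} ‖ξ‖·‖(𝓕φ)(ξ)‖² dξ ≤ 16·m(ℝ³)·∫_{ℝ³} ‖(σ·∇φ)(x)‖²/V_m(x) dx, where the right-hand integrand is interpreted as 0 at points where V_m(x) = +∞. -/

import Mathlib

open MeasureTheory Real FourierTransform

/-- The Coulomb potential generated by a measure `m` on `ℝ³` (real-valued:
`0` where the defining extended-real integral is infinite, so that the
integrand `‖σ·∇φ‖²/V_m` below is interpreted as `0` at such points). -/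
noncomputable def coulomb (m : Measure (EuclideanSpace ℝ (Fin 3)))
    (x : EuclideanSpace ℝ (Fin 3)) : ℝ :=
  (∫⁻ y, ENNReal.ofReal ‖x - y‖⁻¹ ∂m).toReal

/-- The Pauli matrices. -/
noncomputable def pauli : Fin 3 → Matrix (Fin 2) (Fin 2) ℂ :=
  ![!![0, 1; 1, 0], !![0, -Complex.I; Complex.I, 0], !![1, 0; 0, -1]]

/-- `(σ·∇φ)(x) = ∑ⱼ σⱼ (∂ⱼφ)(x)` for `φ : ℝ³ → ℂ²`. -/
noncomputable def pauliDeriv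
    (φ : EuclideanSpace ℝ (Fin 3) → EuclideanSpace ℂ (Fin 2))
    (x : EuclideanSpace ℝ (Fin 3)) : EuclideanSpace ℂ (Fin 2) :=
  ∑ j : Fin 3, (WithLp.equiv 2 (Fin 2 → ℂ)).symm
    ((pauli j).mulVec (WithLp.equiv 2 (Fin 2 → ℂ)
      (fderiv ℝ φ x (EuclideanSpace.single j 1))))

local notation "ℝ³" => EuclideanSpace ℝ (Fin 3)

theorem lintegral_ofReal_of_integral_pos {α : Type*} [MeasurableSpace α] {μ : Measure α}
    {f : α → ℝ} (hf : 0 ≤ᵐ[μ] f) {c : ℝ} (hc : 0 < c) (h : ∫ x, f x ∂μ = c) :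
    ∫⁻ x, ENNReal.ofReal (f x) ∂μ = ENNReal.ofReal c := by
  rw [← h, ofReal_integral_eq_lintegral_ofReal _ hf]
  exact .of_integral_ne_zero (by rw [h]; exact hc.ne')

theorem integral_Ioi_inv_sq_add_sq {ρ : ℝ} (hρ : 0 < ρ) :
    ∫ y in Set.Ioi (0 : ℝ), (y ^ 2 + ρ ^ 2)⁻¹ = π / 2 / ρ := by
  have h := integral_comp_mul_left_Ioi (fun y : ℝ ↦ (1 + y ^ 2)⁻¹) 0 (inv_pos.2 hρ)
  simp only [mul_zero, integral_Ioi_inv_one_add_sq, Real.arctan_zero, sub_zero, inv_inv,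
    smul_eq_mul] at h
  calc _ = ∫ y in Set.Ioi (0 : ℝ), (ρ ^ 2)⁻¹ * (1 + (ρ⁻¹ * y) ^ 2)⁻¹ := by
        congr 1 with y
        field_simp
        ring_nf
    _ = _ := by
        rw [integral_const_mul, h]
        field_simp

theorem lintegral_inv_sq_mul_sq_add_sq {ρ : ℝ} (hρ : 0 < ρ) :
    ∫⁻ η : ℝ³, ENNReal.ofReal ((‖η‖ ^ 2 * (‖η‖ ^ 2 + ρ ^ 2))⁻¹) =
      ENNReal.ofReal (2 * π ^ 2 / ρ) := by
  refine lintegral_ofReal_of_integral_pos (.of_forall fun η ↦ by positivity) (by positivity) ?_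
  rw [integral_fun_norm_addHaar volume (fun r : ℝ ↦ (r ^ 2 * (r ^ 2 + ρ ^ 2))⁻¹)]
  have : ∫ y in Set.Ioi (0 : ℝ), y ^ (Module.finrank ℝ (ℝ³) - 1) •
      (y ^ 2 * (y ^ 2 + ρ ^ 2))⁻¹ = π / 2 / ρ := by
    rw [← integral_Ioi_inv_sq_add_sq hρ]
    refine setIntegral_congr_fun measurableSet_Ioi fun y (hy : 0 < y) ↦ ?_
    simp only [finrank_euclideanSpace_fin, smul_eq_mul]
    norm_num
    field_simp
  rw [this, Measure.real, EuclideanSpace.volume_ball_fin_three]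
  simp
  rw [ENNReal.toReal_ofReal (by positivity)]
  field_simp
  norm_num

theorem inv_mul_inv_norm_sq_le {E : Type*} [NormedAddCommGroup E] {ξ η : E} (hξ : ξ ≠ 0) :
    (‖η‖ ^ 2)⁻¹ * (‖ξ - η‖ ^ 2)⁻¹ ≤
      3 * (‖η‖ ^ 2 * (‖η‖ ^ 2 + ‖ξ‖ ^ 2))⁻¹ +
        3 * (‖ξ - η‖ ^ 2 * (‖ξ - η‖ ^ 2 + ‖ξ‖ ^ 2))⁻¹ := by
  by_cases hη : η = 0
  · simp only [hη, norm_zero]; norm_num; positivity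
  by_cases hd : ξ - η = 0
  · simp only [hd, norm_zero]; norm_num; positivity
  have ha : 0 < ‖η‖ := norm_pos_iff.2 hη
  have hb : 0 < ‖ξ - η‖ := norm_pos_iff.2 hd
  have hr : 0 < ‖ξ‖ := norm_pos_iff.2 hξ
  have ht : ‖ξ‖ ≤ ‖η‖ + ‖ξ - η‖ := by simpa using norm_add_le η (ξ - η)
  generalize ‖η‖ = a at *
  generalize ‖ξ - η‖ = b at *
  generalize ‖ξ‖ = r at *
  have h1 : r ^ 2 ≤ 2 * (a ^ 2 + b ^ 2) := by nlinarith [sq_nonneg (a - b)]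
  have key : ∀ c : ℝ, 0 < c → c ^ 2 ≤ a ^ 2 + b ^ 2 →
      (c ^ 2 * (a ^ 2 + b ^ 2))⁻¹ ≤ 3 * (c ^ 2 * (c ^ 2 + r ^ 2))⁻¹ := by
    intro c hc hle
    rw [← div_eq_mul_inv, inv_le_comm₀ (by positivity) (by positivity), inv_div, div_le_iff₀ (by norm_num)]
    nlinarith [sq_pos_of_pos hc]
  calc (a ^ 2)⁻¹ * (b ^ 2)⁻¹ = (a ^ 2 * (a ^ 2 + b ^ 2))⁻¹ + (b ^ 2 * (a ^ 2 + b ^ 2))⁻¹ := by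
        field_simp; ring
    _ ≤ _ := add_le_add (key a ha (by nlinarith)) (key b hb (by nlinarith))

theorem lintegral_inv_norm_sq_mul_inv_norm_sub_sq_le {ξ : ℝ³} (hξ : ξ ≠ 0) :
    ∫⁻ η, ENNReal.ofReal ((‖η‖ ^ 2)⁻¹ * (‖ξ - η‖ ^ 2)⁻¹) ≤ ENNReal.ofReal (12 * π ^ 2 / ‖ξ‖) := by
  have hr : 0 < ‖ξ‖ := norm_pos_iff.2 hξ
  calc _ ≤ ∫⁻ η, (ENNReal.ofReal 3 * ENNReal.ofReal ((‖η‖ ^ 2 * (‖η‖ ^ 2 + ‖ξ‖ ^ 2))⁻¹) +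
        ENNReal.ofReal 3 *
          ENNReal.ofReal ((‖ξ - η‖ ^ 2 * (‖ξ - η‖ ^ 2 + ‖ξ‖ ^ 2))⁻¹)) := by
        refine lintegral_mono fun η ↦ ?_
        rw [← ENNReal.ofReal_mul (by norm_num), ← ENNReal.ofReal_mul (by norm_num),
          ← ENNReal.ofReal_add (by positivity) (by positivity)]
        exact ENNReal.ofReal_le_ofReal (inv_mul_inv_norm_sq_le hξ)
    _ = _ := by
        rw [lintegral_add_left (by fun_prop), lintegral_const_mul _ (by fun_prop),
          lintegral_const_mul _ (by fun_prop),
          lintegral_sub_left_eq_self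
            (fun η ↦ ENNReal.ofReal ((‖η‖ ^ 2 * (‖η‖ ^ 2 + ‖ξ‖ ^ 2))⁻¹)) ξ,
          lintegral_inv_sq_mul_sq_add_sq hr, ← ENNReal.ofReal_mul (by norm_num),
          ← ENNReal.ofReal_add (by positivity) (by positivity)]
        congr 1
        ring

theorem lintegral_rpow_mul_exp_neg_mul_sq {r : ℝ} (hr : 0 < r) :
    ∫⁻ t in Set.Ioi (0 : ℝ), ENNReal.ofReal (t ^ (-(1 / 2) : ℝ) * rexp (-(π * t) * r ^ 2)) =
      ENNReal.ofReal r⁻¹ := by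
  refine lintegral_ofReal_of_integral_pos ?_ (by positivity) ?_
  · filter_upwards [ae_restrict_mem measurableSet_Ioi] with t (ht : 0 < t)
    positivity
  have h := integral_rpow_mul_exp_neg_mul_Ioi (a := 1 / 2) (r := π * r ^ 2) (by norm_num)
    (by positivity)
  rw [Real.Gamma_one_half_eq, ← sqrt_eq_rpow, sqrt_div zero_le_one, sqrt_one,
    sqrt_mul pi_nonneg, sqrt_sq hr.le] at h
  calc _ = ∫ t in Set.Ioi (0 : ℝ), t ^ ((1 / 2 : ℝ) - 1) * rexp (-(π * r ^ 2 * t)) := by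
        congr 1 with t
        congr 2
        · norm_num
        · ring
    _ = _ := by
        rw [h]
        field_simp

theorem lintegral_rpow_mul_exp_neg_div_sq {r : ℝ} (hr : 0 < r) :
    ∫⁻ t in Set.Ioi (0 : ℝ), ENNReal.ofReal (t ^ (-2 : ℝ) * rexp (-(π * r ^ 2) / t)) =
      ENNReal.ofReal (π * r ^ 2)⁻¹ := by
  refine lintegral_ofReal_of_integral_pos ?_ (by positivity) ?_
  · filter_upwards [ae_restrict_mem measurableSet_Ioi] with t (ht : 0 < t)
    positivity
  have h := integral_comp_rpow_Ioi (fun y : ℝ ↦ rexp (-(π * r ^ 2) * y)) (p := -1) (by norm_num)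
  have h2 := integral_exp_mul_Ioi (a := -(π * r ^ 2)) (by simp; positivity) 0
  rw [h2] at h
  norm_num at h ⊢
  rw [← h]
  refine setIntegral_congr_fun measurableSet_Ioi fun t (ht : 0 < t) ↦ ?_
  simp [rpow_neg_one, div_eq_mul_inv]

/-- Schur's test for the Riesz kernel `‖ξ - η‖⁻²` on `ℝ³` with weight `‖ξ‖²`. -/
theorem lintegral_mul_inv_norm_sub_sq_le {a : ℝ³ → ℝ} (ha : ∀ ξ, 0 ≤ a ξ)
    (ham : AEMeasurable a) :
    ∫⁻ z : ℝ³ × ℝ³,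
        ENNReal.ofReal (a z.1 * a z.2 * (‖z.1 - z.2‖ ^ 2)⁻¹) ≤
      ENNReal.ofReal (12 * π ^ 2) * ∫⁻ ξ, ENNReal.ofReal (‖ξ‖ * a ξ ^ 2) := by
  let k : ℝ³ × ℝ³ → ENNReal := fun z ↦ ENNReal.ofReal
    (a z.1 ^ 2 * ‖z.1‖ ^ 2 * ((‖z.2‖ ^ 2)⁻¹ * (‖z.1 - z.2‖ ^ 2)⁻¹))
  have h1 : AEMeasurable (fun z : ℝ³ × ℝ³ ↦ a z.1) (volume.prod volume) := ham.comp_fst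
  have hk : AEMeasurable k (volume.prod volume) := by
    refine AEMeasurable.ennreal_ofReal (((h1.pow_const 2).mul ?_).mul ?_) <;> fun_prop
  have h0 : ∀ᵐ z : ℝ³ × ℝ³ ∂(volume.prod volume), z.1 ≠ 0 ∧ z.2 ≠ 0 := by
    have := (Measure.ae_ne (volume : Measure ℝ³) 0)
    exact (Measure.quasiMeasurePreserving_fst.ae this).and
      (Measure.quasiMeasurePreserving_snd.ae this)
  have hle : 2 * ∫⁻ z : ℝ³ × ℝ³, ENNReal.ofReal (a z.1 * a z.2 * (‖z.1 - z.2‖ ^ 2)⁻¹)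
      ≤ 2 * ∫⁻ z, k z ∂(volume.prod volume) := by
    calc _ = ∫⁻ z : ℝ³ × ℝ³, 2 * ENNReal.ofReal (a z.1 * a z.2 * (‖z.1 - z.2‖ ^ 2)⁻¹) := by
          rw [lintegral_const_mul' _ _ (by norm_num)]
      _ ≤ ∫⁻ z : ℝ³ × ℝ³, (k z + k z.swap) ∂(volume.prod volume) := by
          refine lintegral_mono_ae ?_
          filter_upwards [h0] with z ⟨hz1, hz2⟩
          have e : (2 : ENNReal) = ENNReal.ofReal 2 := by norm_num
          have p1 := ha z.1
          have p2 := ha z.2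
          refine (congrArg (· * _) e).le.trans ?_
          rw [← ENNReal.ofReal_mul (by norm_num), ← ENNReal.ofReal_add (by positivity)
            (by simp only [Prod.fst_swap, Prod.snd_swap]; positivity)]
          refine ENNReal.ofReal_le_ofReal ?_
          have n1 : 0 < ‖z.1‖ := norm_pos_iff.2 hz1
          have n2 : 0 < ‖z.2‖ := norm_pos_iff.2 hz2
          simp only [Prod.fst_swap, Prod.snd_swap, norm_sub_rev z.2 z.1]
          calc 2 * (a z.1 * a z.2 * (‖z.1 - z.2‖ ^ 2)⁻¹)
              = 2 * (a z.1 * ‖z.1‖ / ‖z.2‖) * (a z.2 * ‖z.2‖ / ‖z.1‖) *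
                (‖z.1 - z.2‖ ^ 2)⁻¹ := by field_simp
            _ ≤ ((a z.1 * ‖z.1‖ / ‖z.2‖) ^ 2 + (a z.2 * ‖z.2‖ / ‖z.1‖) ^ 2) *
                (‖z.1 - z.2‖ ^ 2)⁻¹ := by
                gcongr
                exact two_mul_le_add_sq _ _
            _ = _ := by ring
      _ = 2 * ∫⁻ z, k z ∂(volume.prod volume) := by
          rw [lintegral_add_left' hk, lintegral_prod_swap, two_mul]
  refine (ENNReal.mul_le_mul_iff_right (by norm_num) (by norm_num)).1 hle |>.trans ?_
  rw [lintegral_prod _ hk, ← lintegral_const_mul' _ _ ENNReal.ofReal_ne_top]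
  refine lintegral_mono_ae ?_
  filter_upwards [Measure.ae_ne (volume : Measure ℝ³) 0] with ξ hξ
  have n1 : 0 < ‖ξ‖ := norm_pos_iff.2 hξ
  calc ∫⁻ η, k (ξ, η) = ENNReal.ofReal (a ξ ^ 2 * ‖ξ‖ ^ 2) *
        ∫⁻ η, ENNReal.ofReal ((‖η‖ ^ 2)⁻¹ * (‖ξ - η‖ ^ 2)⁻¹) := by
        rw [← lintegral_const_mul' _ _ ENNReal.ofReal_ne_top]
        congr 1 with η
        rw [← ENNReal.ofReal_mul (by positivity)]
    _ ≤ ENNReal.ofReal (a ξ ^ 2 * ‖ξ‖ ^ 2) * ENNReal.ofReal (12 * π ^ 2 / ‖ξ‖) := by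
        gcongr
        exact lintegral_inv_norm_sq_mul_inv_norm_sub_sq_le hξ
    _ = _ := by
        rw [← ENNReal.ofReal_mul (by positivity), ← ENNReal.ofReal_mul (by positivity)]
        congr 1
        field_simp

theorem continuous_fourier_of_integrable {F : Type*} [NormedAddCommGroup F] [NormedSpace ℂ F]
    {w : ℝ³ → F} (hw : Integrable w) : Continuous (𝓕 w) :=
  VectorFourier.fourierIntegral_continuous Real.continuous_fourierChar continuous_inner hw

section Kato

variable {F : Type*} [NormedAddCommGroup F] [InnerProductSpace ℂ F] [CompleteSpace F]

theorem integral_inner_fourier_eq {V : Type*} [NormedAddCommGroup V] [InnerProductSpace ℝ V]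
    [FiniteDimensional ℝ V] [MeasurableSpace V] [BorelSpace V] {f g : V → F} (hf : Integrable f)
    (hg : Integrable g) :
    ∫ ξ, inner ℂ (𝓕 f ξ) (g ξ) = ∫ x, inner ℂ (f x) (𝓕⁻ g x) := by
  have h := VectorFourier.integral_sesq_fourierIntegral_eq_neg_flip (L := innerₗ V)
    (innerSL ℂ) Real.continuous_fourierChar continuous_inner hf hg
  rw [flip_innerₗ] at h
  exact h

theorem norm_fourierInv_gaussian_smul_fourier_le {w : ℝ³ → F}
    (hw : Integrable w) {t : ℝ} (ht : 0 < t) (ξ : ℝ³) :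
    ‖𝓕⁻ (fun x ↦ (rexp (-(π * t) * ‖x‖ ^ 2) : ℂ) • 𝓕 w x) ξ‖ ≤
      ∫ η, t ^ (-(3 / 2) : ℝ) * rexp (-(π * ‖ξ - η‖ ^ 2) / t) * ‖w η‖ := by
  have hb : 0 < ((π * t : ℝ) : ℂ).re := by simp; positivity
  let h : ℝ³ → ℂ := fun v ↦
    Complex.exp (-((π * t : ℝ) : ℂ) * ‖v‖ ^ 2 + 2 * π * Complex.I * (inner ℝ ξ v : ℝ))
  have hint : Integrable h := GaussianFourier.integrable_cexp_neg_mul_sq_norm_add hb _ ξ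
  have e1 : 𝓕⁻ (fun x ↦ (rexp (-(π * t) * ‖x‖ ^ 2) : ℂ) • 𝓕 w x) ξ = ∫ η, 𝓕 h η • w η := by
    rw [fourierInv_eq']
    refine .trans ?_ (VectorFourier.integral_fourierIntegral_smul_eq_flip (L := innerₗ _)
      Real.continuous_fourierChar continuous_inner hint hw).symm
    congr 1 with x
    rw [smul_smul]
    congr 1
    simp only [h, Complex.ofReal_exp]
    rw [← Complex.exp_add]
    congr 1
    rw [real_inner_comm]
    · push_cast
      ring
    · rw [flip_innerₗ]
      rfl
  rw [e1]
  refine (norm_integral_le_integral_norm _).trans (le_of_eq ?_)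
  congr 1 with η
  rw [norm_smul, fourier_gaussian_innerProductSpace' hb, norm_mul]
  congr 2
  · have hπ : (π : ℂ) / ((π * t : ℝ) : ℂ) = ((t⁻¹ : ℝ) : ℂ) := by
      push_cast
      field_simp
    rw [hπ, finrank_euclideanSpace_fin, Complex.norm_cpow_eq_rpow_re_of_pos (by positivity),
      inv_rpow ht.le, rpow_neg ht.le]
    norm_num
  · rw [Complex.norm_exp]
    congr 1
    have : -(π : ℂ) ^ 2 * (‖ξ - η‖ : ℂ) ^ 2 / ((π * t : ℝ) : ℂ) =
        ((-(π * ‖ξ - η‖ ^ 2) / t : ℝ) : ℂ) := by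
      push_cast
      field_simp
    rw [this, Complex.ofReal_re]

theorem lintegral_gaussian_mul_norm_fourier_sq_le {w : ℝ³ → F}
    (hw : Integrable w) {t : ℝ} (ht : 0 < t) :
    ∫⁻ x, ENNReal.ofReal (rexp (-(π * t) * ‖x‖ ^ 2) * ‖𝓕 w x‖ ^ 2) ≤
      ∫⁻ z : ℝ³ × ℝ³,
        ENNReal.ofReal (t ^ (-(3 / 2) : ℝ) * rexp (-(π * ‖z.1 - z.2‖ ^ 2) / t) *
          (‖w z.1‖ * ‖w z.2‖)) := by
  have hu : Continuous (𝓕 w) := continuous_fourier_of_integrable hw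
  have hub (x) : ‖𝓕 w x‖ ≤ ∫ v, ‖w v‖ := VectorFourier.norm_fourierIntegral_le_integral_norm _ _ _ _ _
  have hg : Integrable (fun x : ℝ³ ↦ rexp (-(π * t) * ‖x‖ ^ 2)) := by
    refine .of_integral_ne_zero ?_
    rw [GaussianFourier.integral_rexp_neg_mul_sq_norm (by positivity)]
    positivity
  let f : ℝ³ → F := fun x ↦ (rexp (-(π * t) * ‖x‖ ^ 2) : ℂ) • 𝓕 w x
  have hf : Integrable f := by
    refine hg.ofReal.smul_bdd (∫ v, ‖w v‖) hu.aestronglyMeasurable (.of_forall hub)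
  have hgu : Integrable (fun x ↦ rexp (-(π * t) * ‖x‖ ^ 2) * ‖𝓕 w x‖ ^ 2) := by
    refine hg.mul_bdd (c := (∫ v, ‖w v‖) ^ 2) (hu.norm.pow 2).aestronglyMeasurable
      (.of_forall fun x ↦ ?_)
    simp only [norm_pow, norm_norm]
    gcongr
    exact hub x
  have hG : Integrable (fun z : ℝ³ × ℝ³ ↦
      t ^ (-(3 / 2) : ℝ) * rexp (-(π * ‖z.1 - z.2‖ ^ 2) / t) * (‖w z.1‖ * ‖w z.2‖)) := by
    refine (hw.norm.mul_prod hw.norm).bdd_mul (c := t ^ (-(3 / 2) : ℝ)) ?_ (.of_forall fun z ↦ ?_)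
    · exact Continuous.aestronglyMeasurable (by fun_prop)
    · rw [Real.norm_of_nonneg (by positivity)]
      refine mul_le_of_le_one_right (by positivity) (exp_le_one_iff.2 ?_)
      rw [neg_div]
      exact neg_nonpos.2 (by positivity)
  have key : ∫ x, rexp (-(π * t) * ‖x‖ ^ 2) * ‖𝓕 w x‖ ^ 2 ≤ ∫ z : ℝ³ × ℝ³,
      t ^ (-(3 / 2) : ℝ) * rexp (-(π * ‖z.1 - z.2‖ ^ 2) / t) * (‖w z.1‖ * ‖w z.2‖) := by
    have e : ((∫ x, rexp (-(π * t) * ‖x‖ ^ 2) * ‖𝓕 w x‖ ^ 2 : ℝ) : ℂ) =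
        ∫ ξ, inner ℂ (w ξ) (𝓕⁻ f ξ) := by
      rw [← integral_inner_fourier_eq hw hf, ← integral_complex_ofReal]
      congr 1 with x
      simp only [f, inner_smul_right, inner_self_eq_norm_sq_to_K]
      push_cast
      rfl
    rw [Measure.volume_eq_prod, integral_prod _ hG]
    calc _ = ‖((∫ x, rexp (-(π * t) * ‖x‖ ^ 2) * ‖𝓕 w x‖ ^ 2 : ℝ) : ℂ)‖ := by
          rw [Complex.norm_real, Real.norm_of_nonneg (integral_nonneg fun x ↦ by positivity)]
      _ ≤ ∫ ξ, ‖inner ℂ (w ξ) (𝓕⁻ f ξ)‖ := by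
          rw [e]
          exact norm_integral_le_integral_norm _
      _ ≤ _ := by
          refine integral_mono_of_nonneg (.of_forall fun ξ ↦ by positivity) hG.integral_prod_left
            (.of_forall fun ξ ↦ ?_)
          calc _ ≤ ‖w ξ‖ * ‖𝓕⁻ f ξ‖ := norm_inner_le_norm _ _
            _ ≤ ‖w ξ‖ * ∫ η, t ^ (-(3 / 2) : ℝ) * rexp (-(π * ‖ξ - η‖ ^ 2) / t) * ‖w η‖ := by
              gcongr
              exact norm_fourierInv_gaussian_smul_fourier_le hw ht ξ
            _ = _ := by
              rw [← integral_const_mul]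
              congr 1 with η
              ring
  rw [← ofReal_integral_eq_lintegral_ofReal hgu (.of_forall fun x ↦ by positivity),
    ← ofReal_integral_eq_lintegral_ofReal hG (.of_forall fun x ↦ by positivity)]
  exact ENNReal.ofReal_le_ofReal key

/-- Kato's inequality on the Fourier side, with a non-sharp constant. -/
theorem lintegral_norm_fourier_sq_div_norm_le {w : ℝ³ → F} (hw : Integrable w) :
    ∫⁻ x, ENNReal.ofReal (‖𝓕 w x‖ ^ 2 * ‖x‖⁻¹) ≤
      ENNReal.ofReal (12 * π) * ∫⁻ ξ, ENNReal.ofReal (‖ξ‖ * ‖w ξ‖ ^ 2) := by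
  have hu : Continuous (𝓕 w) := continuous_fourier_of_integrable hw
  have hwm : AEMeasurable (fun z : ℝ³ × ℝ³ ↦ ‖w z.1‖ * ‖w z.2‖) (volume.prod volume) :=
    (hw.norm.mul_prod hw.norm).aestronglyMeasurable.aemeasurable
  calc ∫⁻ x, ENNReal.ofReal (‖𝓕 w x‖ ^ 2 * ‖x‖⁻¹)
      = ∫⁻ x, ∫⁻ t in Set.Ioi (0 : ℝ), ENNReal.ofReal (t ^ (-(1 / 2) : ℝ)) *
          ENNReal.ofReal (rexp (-(π * t) * ‖x‖ ^ 2) * ‖𝓕 w x‖ ^ 2) := by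
        refine lintegral_congr_ae ?_
        filter_upwards [Measure.ae_ne (volume : Measure ℝ³) 0] with x hx
        rw [ENNReal.ofReal_mul (by positivity),
          ← lintegral_rpow_mul_exp_neg_mul_sq (norm_pos_iff.2 hx),
          ← lintegral_const_mul' _ _ ENNReal.ofReal_ne_top]
        refine setLIntegral_congr_fun measurableSet_Ioi fun t (ht : 0 < t) ↦ ?_
        rw [← ENNReal.ofReal_mul (by positivity), ← ENNReal.ofReal_mul (by positivity)]
        congr 1
        ring
    _ = ∫⁻ t in Set.Ioi (0 : ℝ), ENNReal.ofReal (t ^ (-(1 / 2) : ℝ)) *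
          ∫⁻ x, ENNReal.ofReal (rexp (-(π * t) * ‖x‖ ^ 2) * ‖𝓕 w x‖ ^ 2) := by
        rw [lintegral_lintegral_swap]
        · simp_rw [lintegral_const_mul' _ _ ENNReal.ofReal_ne_top]
        · refine Measurable.aemeasurable ?_
          have : Measurable fun z : ℝ³ × ℝ ↦ ‖𝓕 w z.1‖ := hu.norm.measurable.comp measurable_fst
          unfold Function.uncurry
          fun_prop
    _ ≤ ∫⁻ t in Set.Ioi (0 : ℝ), ENNReal.ofReal (t ^ (-(1 / 2) : ℝ)) * ∫⁻ z : ℝ³ × ℝ³,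
          ENNReal.ofReal (t ^ (-(3 / 2) : ℝ) * rexp (-(π * ‖z.1 - z.2‖ ^ 2) / t) *
            (‖w z.1‖ * ‖w z.2‖)) := by
        refine setLIntegral_mono_ae' measurableSet_Ioi (.of_forall fun t (ht : 0 < t) ↦ ?_)
        gcongr
        exact lintegral_gaussian_mul_norm_fourier_sq_le hw ht
    _ = ∫⁻ z : ℝ³ × ℝ³, ∫⁻ t in Set.Ioi (0 : ℝ), ENNReal.ofReal (t ^ (-(1 / 2) : ℝ)) *
          ENNReal.ofReal (t ^ (-(3 / 2) : ℝ) * rexp (-(π * ‖z.1 - z.2‖ ^ 2) / t) *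
            (‖w z.1‖ * ‖w z.2‖)) := by
        rw [lintegral_lintegral_swap]
        · simp_rw [lintegral_const_mul' _ _ ENNReal.ofReal_ne_top]
        · have := hwm.comp_fst (ν := volume.restrict (Set.Ioi (0 : ℝ)))
          unfold Function.uncurry
          refine AEMeasurable.mul ?_ (AEMeasurable.ennreal_ofReal (AEMeasurable.mul ?_ this))
          · fun_prop
          · fun_prop
    _ = ∫⁻ z : ℝ³ × ℝ³, ENNReal.ofReal π⁻¹ *
          ENNReal.ofReal (‖w z.1‖ * ‖w z.2‖ * (‖z.1 - z.2‖ ^ 2)⁻¹) := by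
        refine lintegral_congr_ae ?_
        have hne : ∀ᵐ z : ℝ³ × ℝ³ ∂(volume.prod volume), z.1 - z.2 ≠ 0 := by
          rw [Measure.ae_prod_iff_ae_ae]
          · refine .of_forall fun ξ ↦ ?_
            filter_upwards [Measure.ae_ne (volume : Measure ℝ³) ξ] with η hη
            exact sub_ne_zero.2 hη.symm
          · exact (measurableSet_eq_fun (by fun_prop) (by fun_prop)).compl
        filter_upwards [hne] with z hz
        rw [← ENNReal.ofReal_mul (by positivity)]
        calc _ = ∫⁻ t in Set.Ioi (0 : ℝ), ENNReal.ofReal (‖w z.1‖ * ‖w z.2‖) *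
              ENNReal.ofReal (t ^ (-2 : ℝ) * rexp (-(π * ‖z.1 - z.2‖ ^ 2) / t)) := by
              refine setLIntegral_congr_fun measurableSet_Ioi fun t (ht : 0 < t) ↦ ?_
              rw [← ENNReal.ofReal_mul (by positivity), ← ENNReal.ofReal_mul (by positivity),
                show (-2 : ℝ) = -(1 / 2) + -(3 / 2) by norm_num, rpow_add ht]
              congr 1
              ring
          _ = _ := by
              rw [lintegral_const_mul' _ _ ENNReal.ofReal_ne_top,
                lintegral_rpow_mul_exp_neg_div_sq (norm_pos_iff.2 hz),
                ← ENNReal.ofReal_mul (by positivity)]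
              congr 1
              rw [mul_inv]
              ring
    _ ≤ _ := by
        rw [lintegral_const_mul' _ _ ENNReal.ofReal_ne_top]
        grw [lintegral_mul_inv_norm_sub_sq_le (fun ξ ↦ norm_nonneg (w ξ))
          hw.norm.aestronglyMeasurable.aemeasurable]
        rw [← mul_assoc, ← ENNReal.ofReal_mul (by positivity)]
        refine le_of_eq ?_
        congr 2
        field_simp

theorem lintegral_norm_fourierInv_sq_div_norm_sub_le {w : ℝ³ → F} (hw : Integrable w) (y : ℝ³) :
    ∫⁻ x, ENNReal.ofReal (‖𝓕⁻ w x‖ ^ 2 * ‖x - y‖⁻¹) ≤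
      ENNReal.ofReal (12 * π) * ∫⁻ ξ, ENNReal.ofReal (‖ξ‖ * ‖w ξ‖ ^ 2) := by
  let w' : ℝ³ → F := fun ξ ↦ 𝐞 (inner ℝ ξ y) • w ξ
  have hw' : Integrable w' := by
    simpa [w'] using (Real.fourierIntegral_convergent_iff (μ := volume) (-y)).2 hw
  have hn (ξ) : ‖w' ξ‖ = ‖w ξ‖ := Circle.norm_smul _ _
  have hF (x) : 𝓕 w' x = 𝓕⁻ w (y - x) := by
    rw [fourierInv_eq, fourier_eq]
    congr 1 with ξ
    rw [smul_smul, ← AddChar.map_add_eq_mul]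
    congr 2
    rw [inner_sub_right]
    ring
  have := lintegral_norm_fourier_sq_div_norm_le hw'
  simp only [hn, hF] at this
  rw [← lintegral_sub_left_eq_self _ y] at this
  simpa [norm_sub_rev] using this

end Kato

theorem pauliDeriv_eq (φ : ℝ³ → EuclideanSpace ℂ (Fin 2)) (x : ℝ³) :
    pauliDeriv φ x = ∑ j, Matrix.toEuclideanCLM (𝕜 := ℂ) (pauli j)
      (fderiv ℝ φ x (EuclideanSpace.single j 1)) := rfl

theorem norm_sum_smul_pauli (ξ : ℝ³) (v : EuclideanSpace ℂ (Fin 2)) :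
    ‖∑ j, (ξ j : ℂ) • Matrix.toEuclideanCLM (𝕜 := ℂ) (pauli j) v‖ = ‖ξ‖ * ‖v‖ := by
  rw [← sq_eq_sq₀ (norm_nonneg _) (by positivity), mul_pow, EuclideanSpace.norm_sq_eq,
    EuclideanSpace.norm_sq_eq, EuclideanSpace.norm_sq_eq]
  simp [Fin.sum_univ_three, Fin.sum_univ_two, pauli, Matrix.ofLp_toEuclideanCLM, Matrix.mulVec,
    dotProduct, Complex.sq_norm, Complex.normSq_apply]
  ring

theorem fourier_clm_comp {F G : Type*} [NormedAddCommGroup F] [NormedSpace ℂ F] [CompleteSpace F]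
    [NormedAddCommGroup G] [NormedSpace ℂ G] [CompleteSpace G] (L : F →L[ℂ] G) {f : ℝ³ → F}
    (hf : Integrable f) (ξ : ℝ³) : 𝓕 (fun x ↦ L (f x)) ξ = L (𝓕 f ξ) := by
  simp only [fourier_eq]
  rw [← L.integral_comp_comm ((Real.fourierIntegral_convergent_iff ξ).2 hf)]
  simp [Circle.smul_def]

section Pauli

variable {φ : ℝ³ → EuclideanSpace ℂ (Fin 2)}

theorem continuous_pauliDeriv (hφ : ContDiff ℝ (⊤ : ℕ∞) φ) : Continuous (pauliDeriv φ) := by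
  have := hφ.continuous_fderiv (by simp)
  simp only [funext (pauliDeriv_eq φ)]
  fun_prop

theorem hasCompactSupport_pauliDeriv (hsupp : HasCompactSupport φ) :
    HasCompactSupport (pauliDeriv φ) := by
  refine (hsupp.fderiv ℝ).mono fun x hx ↦ ?_
  contrapose! hx
  simp only [Function.mem_support, not_not] at hx ⊢
  simp [pauliDeriv_eq, hx]

theorem norm_fourier_pauliDeriv (hφ : ContDiff ℝ (⊤ : ℕ∞) φ) (hsupp : HasCompactSupport φ)
    (ξ : ℝ³) : ‖𝓕 (pauliDeriv φ) ξ‖ = 2 * π * ‖ξ‖ * ‖𝓕 φ ξ‖ := by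
  have hd := hφ.continuous_fderiv (by simp)
  have hdi : Integrable (fderiv ℝ φ) := hd.integrable_of_hasCompactSupport (hsupp.fderiv ℝ)
  have hj (j : Fin 3) : Integrable fun x ↦ fderiv ℝ φ x (EuclideanSpace.single j 1) :=
    hdi.apply_continuousLinearMap _
  have e : 𝓕 (pauliDeriv φ) ξ =
      (2 * π * Complex.I) • ∑ j, (ξ j : ℂ) • Matrix.toEuclideanCLM (𝕜 := ℂ) (pauli j) (𝓕 φ ξ) := by
    calc _ = ∑ j, 𝓕 (fun x ↦ Matrix.toEuclideanCLM (𝕜 := ℂ) (pauli j)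
          (fderiv ℝ φ x (EuclideanSpace.single j 1))) ξ := by
          simp only [fourier_eq, pauliDeriv_eq, Finset.smul_sum]
          refine integral_finsetSum _ fun j _ ↦ ?_
          exact (Real.fourierIntegral_convergent_iff ξ).2
            ((Matrix.toEuclideanCLM (𝕜 := ℂ) (pauli j)).integrable_comp (hj j))
      _ = _ := by
          rw [Finset.smul_sum]
          refine Finset.sum_congr rfl fun j _ ↦ ?_
          rw [fourier_clm_comp _ (hj j), ← fourier_continuousLinearMap_apply hdi,
            fourier_fderiv (hφ.continuous.integrable_of_hasCompactSupport hsupp)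
              (hφ.differentiable (by simp)) hdi, VectorFourier.fourierSMulRight_apply]
          have : innerSL ℝ ξ (EuclideanSpace.single j 1) = ξ j :=
            (EuclideanSpace.inner_single_right j 1 ξ).trans (by simp)
          simp [this]
  rw [e, norm_smul, norm_sum_smul_pauli]
  simp [abs_of_nonneg pi_nonneg]
  ring

end Pauli

section Coulomb

variable (m : Measure ℝ³) [IsFiniteMeasure m]

theorem measurable_lintegral_inv_norm_sub :
    Measurable fun x : ℝ³ ↦ ∫⁻ y, ENNReal.ofReal ‖x - y‖⁻¹ ∂m := by
  refine Measurable.lintegral_prod_right' (f := fun z : ℝ³ × ℝ³ ↦ ENNReal.ofReal ‖z.1 - z.2‖⁻¹) ?_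
  fun_prop

theorem measurable_coulomb : Measurable (coulomb m) :=
  (measurable_lintegral_inv_norm_sub m).ennreal_toReal

theorem ae_ae_ne : ∀ᵐ x : ℝ³, ∀ᵐ y ∂m, x ≠ y := by
  have hs : MeasurableSet {z : ℝ³ × ℝ³ | z.1 ≠ z.2} :=
    (measurableSet_eq_fun measurable_fst measurable_snd).compl
  exact (Measure.ae_ae_comm hs).2 (.of_forall fun y ↦ Measure.ae_ne volume y)

theorem ae_mul_le_lintegral_inv_norm_sub (R : ℝ) : ∀ᵐ x : ℝ³, ‖x‖ ≤ R →
    ENNReal.ofReal (2 * R)⁻¹ * m (Metric.closedBall 0 R) ≤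
      ∫⁻ y, ENNReal.ofReal ‖x - y‖⁻¹ ∂m := by
  filter_upwards [ae_ae_ne m] with x hx hxR
  rw [← setLIntegral_const]
  refine (setLIntegral_mono_ae' measurableSet_closedBall ?_).trans (setLIntegral_le_lintegral _ _)
  filter_upwards [hx] with y hy hyR
  have := norm_pos_iff.2 (sub_ne_zero.2 hy)
  rw [mem_closedBall_zero_iff] at hyR
  gcongr
  linarith [norm_sub_le x y]

theorem exists_ae_le_lintegral_inv_norm_sub (hm : m ≠ 0) {s : Set ℝ³} (hs : Bornology.IsBounded s) :
    ∃ c : ℝ, 0 < c ∧ ∀ᵐ x : ℝ³, x ∈ s →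
      ENNReal.ofReal c ≤ ∫⁻ y, ENNReal.ofReal ‖x - y‖⁻¹ ∂m := by
  obtain ⟨R₁, hR₁⟩ := hs.subset_closedBall (0 : ℝ³)
  obtain ⟨R₂, hR₂⟩ : ∃ n : ℕ, m (Metric.closedBall 0 n) ≠ 0 := by
    by_contra! h
    refine hm (Measure.measure_univ_eq_zero.1 ?_)
    rw [← Metric.iUnion_closedBall_nat (0 : ℝ³)]
    exact measure_iUnion_null h
  obtain ⟨R, hR, hRR₁, hRR₂⟩ : ∃ R : ℝ, 0 < R ∧ R₁ ≤ R ∧ R₂ ≤ R :=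
    ⟨max 1 (max R₁ R₂), by positivity, by simp, by simp⟩
  have hRm : m (Metric.closedBall 0 R) ≠ 0 := fun h ↦
    hR₂ (measure_mono_null (Metric.closedBall_subset_closedBall hRR₂) h)
  refine ⟨(2 * R)⁻¹ * (m (Metric.closedBall 0 R)).toReal,
    mul_pos (by positivity) (ENNReal.toReal_pos hRm (measure_ne_top _ _)), ?_⟩
  filter_upwards [ae_mul_le_lintegral_inv_norm_sub m R] with x hx hxs
  rw [ENNReal.ofReal_mul (by positivity), ENNReal.ofReal_toReal (measure_ne_top _ _)]
  exact hx (by simpa using (hR₁ hxs).trans hRR₁)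

theorem integrable_norm_sq_div_coulomb {F : Type*} [NormedAddCommGroup F] (hm : m ≠ 0)
    {ψ : ℝ³ → F} (hψ : Continuous ψ) (hs : HasCompactSupport ψ) :
    Integrable fun x ↦ ‖ψ x‖ ^ 2 / coulomb m x := by
  obtain ⟨c, hc, hcV⟩ := exists_ae_le_lintegral_inv_norm_sub m hm hs.isBounded
  have hψ2 : Integrable fun x ↦ ‖ψ x‖ ^ 2 := by
    have : HasCompactSupport fun x ↦ ‖ψ x‖ ^ 2 := hs.norm.comp_left (g := (· ^ 2)) (by simp)
    exact (hψ.norm.pow 2).integrable_of_hasCompactSupport this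
  have hmeas : Measurable fun x ↦ ‖ψ x‖ ^ 2 / coulomb m x :=
    (hψ.norm.pow 2).measurable.div (measurable_coulomb m)
  refine Integrable.mono' (g := fun x ↦ ‖ψ x‖ ^ 2 / c) (hψ2.div_const c)
    hmeas.aestronglyMeasurable ?_
  filter_upwards [hcV] with x hx
  have hV : 0 ≤ coulomb m x := ENNReal.toReal_nonneg
  rw [Real.norm_of_nonneg (by positivity)]
  by_cases hxs : x ∈ tsupport ψ
  · by_cases ht : ∫⁻ y, ENNReal.ofReal ‖x - y‖⁻¹ ∂m = ⊤
    · have h0 : coulomb m x = 0 := by simp [coulomb, ht]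
      rw [h0, div_zero]
      positivity
    · have : c ≤ coulomb m x := (ENNReal.ofReal_le_iff_le_toReal ht).1 (hx hxs)
      gcongr
  · simp [image_eq_zero_of_notMem_tsupport hxs]

theorem lintegral_coulomb_mul_norm_fourierInv_sq_le {F : Type*} [NormedAddCommGroup F]
    [InnerProductSpace ℂ F] [CompleteSpace F] {w : ℝ³ → F} (hw : Integrable w) :
    ∫⁻ x, (∫⁻ y, ENNReal.ofReal ‖x - y‖⁻¹ ∂m) * ENNReal.ofReal (‖𝓕⁻ w x‖ ^ 2) ≤
      ENNReal.ofReal (12 * π) * (∫⁻ ξ, ENNReal.ofReal (‖ξ‖ * ‖w ξ‖ ^ 2)) * m Set.univ := by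
  have hu : Continuous (𝓕⁻ w) := by
    rw [fourierInv_eq_fourier_comp_neg]
    exact continuous_fourier_of_integrable hw.comp_neg
  calc _ = ∫⁻ x, ∫⁻ y, ENNReal.ofReal (‖𝓕⁻ w x‖ ^ 2 * ‖x - y‖⁻¹) ∂m := by
        congr 1 with x
        rw [mul_comm, ← lintegral_const_mul' _ _ ENNReal.ofReal_ne_top]
        simp_rw [ENNReal.ofReal_mul (sq_nonneg _)]
    _ = ∫⁻ y, (∫⁻ x, ENNReal.ofReal (‖𝓕⁻ w x‖ ^ 2 * ‖x - y‖⁻¹)) ∂m := by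
        rw [lintegral_lintegral_swap]
        have : Measurable fun z : ℝ³ × ℝ³ ↦ ‖𝓕⁻ w z.1‖ := hu.norm.measurable.comp measurable_fst
        unfold Function.uncurry
        fun_prop
    _ ≤ ∫⁻ y, (ENNReal.ofReal (12 * π) * ∫⁻ ξ, ENNReal.ofReal (‖ξ‖ * ‖w ξ‖ ^ 2)) ∂m :=
        lintegral_mono fun y ↦ lintegral_norm_fourierInv_sq_div_norm_sub_le hw y
    _ = _ := by rw [lintegral_const]

end Coulomb

theorem two_mul_ofReal_mul_le {V : ENNReal} (hV : V ≠ 0) {a b c : ℝ} (hb : 0 ≤ b)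
    (hc : 0 < c) :
    2 * ENNReal.ofReal (a * b) ≤ ENNReal.ofReal c⁻¹ * (V * ENNReal.ofReal (b ^ 2)) +
      ENNReal.ofReal c * ENNReal.ofReal (a ^ 2 / V.toReal) := by
  by_cases hVt : V = ⊤
  · rcases hb.eq_or_lt with rfl | hb
    · simp
    · rw [hVt, ENNReal.top_mul (by simp; positivity), ENNReal.mul_top (by simpa using hc), top_add]
      exact le_top
  have hv := ENNReal.toReal_pos hV hVt
  rw [← ENNReal.ofReal_toReal hVt, ENNReal.toReal_ofReal hv.le]
  generalize V.toReal = v at hv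
  rw [← ENNReal.ofReal_mul (by positivity), ← ENNReal.ofReal_mul (by positivity),
    ← ENNReal.ofReal_mul (by positivity), ← ENNReal.ofReal_add (by positivity) (by positivity)]
  have e2 : (2 : ENNReal) = ENNReal.ofReal 2 := by norm_num
  refine (congrArg (· * _) e2).le.trans ?_
  rw [← ENNReal.ofReal_mul (by positivity)]
  refine ENNReal.ofReal_le_ofReal ?_
  have : c⁻¹ * (v * b ^ 2) + c * (a ^ 2 / v) - 2 * (a * b) = (v * b - c * a) ^ 2 / (c * v) := by
    field_simp
    ring
  have h2 : 0 ≤ (v * b - c * a) ^ 2 / (c * v) := by positivity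
  linarith

theorem halfLaplacian_form_le_weighted_pauli
    (m : Measure (EuclideanSpace ℝ (Fin 3))) [IsFiniteMeasure m] (hm : m ≠ 0)
    (φ : EuclideanSpace ℝ (Fin 3) → EuclideanSpace ℂ (Fin 2))
    (hφ : ContDiff ℝ (⊤ : ℕ∞) φ) (hsupp : HasCompactSupport φ) :
    2 * π * (∫ ξ, ‖ξ‖ * ‖𝓕 φ ξ‖ ^ 2) ≤
      16 * (m Set.univ).toReal * ∫ x, ‖pauliDeriv φ x‖ ^ 2 / coulomb m x := by
  set ψ := pauliDeriv φ with hψdef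
  have hψ : Continuous ψ := continuous_pauliDeriv hφ
  have hψs : HasCompactSupport ψ := hasCompactSupport_pauliDeriv hsupp
  have hψi : Integrable ψ := hψ.integrable_of_hasCompactSupport hψs
  have hB := integrable_norm_sq_div_coulomb m hm hψ hψs
  let Φ : SchwartzMap ℝ³ (EuclideanSpace ℂ (Fin 2)) := 𝓕 (hsupp.toSchwartzMap hφ)
  have hΦ : ⇑Φ = 𝓕 φ := SchwartzMap.fourier_coe _
  have hΦi : Integrable (𝓕 φ) := hΦ ▸ Φ.integrable
  have hJ : Integrable fun ξ ↦ ‖ξ‖ * ‖𝓕 φ ξ‖ ^ 2 := by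
    have h1 : Integrable fun ξ ↦ ‖ξ‖ * ‖Φ ξ‖ := by simpa using Φ.integrable_pow_mul volume 1
    obtain ⟨C, hC⟩ : ∃ C, ∀ ξ, ‖Φ ξ‖ ≤ C := by
      obtain ⟨C, -, hC⟩ := Φ.decay 0 0
      exact ⟨C, by simpa using hC⟩
    rw [← hΦ]
    refine (h1.mul_bdd (c := C) Φ.continuous.norm.aestronglyMeasurable
      (.of_forall fun ξ ↦ by simpa using hC ξ)).congr (.of_forall fun ξ ↦ ?_)
    simp only
    ring
  let w : ℝ³ → EuclideanSpace ℂ (Fin 2) := fun ξ ↦ ((‖ξ‖⁻¹ : ℝ) : ℂ) • 𝓕 ψ ξ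
  have hwn (ξ : ℝ³) (hξ : ξ ≠ 0) : ‖w ξ‖ = 2 * π * ‖𝓕 φ ξ‖ := by
    have := norm_pos_iff.2 hξ
    simp only [w, norm_smul, Complex.norm_real, norm_inv, norm_norm]
    rw [norm_fourier_pauliDeriv hφ hsupp]
    field_simp
  have hne := Measure.ae_ne (volume : Measure ℝ³) 0
  have hw : Integrable w := by
    refine (hΦi.norm.const_mul (2 * π)).mono' ?_ ?_
    · refine Measurable.aestronglyMeasurable ?_
      have := (continuous_fourier_of_integrable hψi).measurable
      fun_prop
    · filter_upwards [hne] with ξ hξ using (hwn ξ hξ).le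
  set J := 4 * π ^ 2 * ∫ ξ, ‖ξ‖ * ‖𝓕 φ ξ‖ ^ 2 with hJdef
  have hJ0 : 0 ≤ J := mul_nonneg (by positivity) (integral_nonneg fun ξ ↦ by positivity)
  have hwJ : ∫⁻ ξ, ENNReal.ofReal (‖ξ‖ * ‖w ξ‖ ^ 2) = ENNReal.ofReal J := by
    rw [hJdef, ← integral_const_mul, ofReal_integral_eq_lintegral_ofReal (hJ.const_mul _)
      (.of_forall fun ξ ↦ by positivity)]
    refine lintegral_congr_ae ?_
    filter_upwards [hne] with ξ hξ
    rw [hwn ξ hξ]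
    congr 1
    ring
  have hpair : ENNReal.ofReal J ≤ ∫⁻ x, ENNReal.ofReal (‖ψ x‖ * ‖𝓕⁻ w x‖) := by
    have e : (J : ℂ) = ∫ x, inner ℂ (ψ x) (𝓕⁻ w x) := by
      rw [← integral_inner_fourier_eq hψi hw, hJdef, ← integral_const_mul, ← integral_complex_ofReal]
      refine integral_congr_ae ?_
      filter_upwards [hne] with ξ hξ
      have h0 : (‖ξ‖ : ℂ) ≠ 0 := by simpa using hξ
      simp only [w, inner_smul_right, inner_self_eq_norm_sq_to_K,
        norm_fourier_pauliDeriv hφ hsupp, ψ]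
      simp
      field_simp
      ring
    calc ENNReal.ofReal J = ‖(J : ℂ)‖ₑ := by
          rw [← ofReal_norm, Complex.norm_real, Real.norm_of_nonneg hJ0]
      _ ≤ ∫⁻ x, ‖inner ℂ (ψ x) (𝓕⁻ w x)‖ₑ := by
          rw [e]
          exact enorm_integral_le_lintegral_enorm _
      _ ≤ _ := by
          refine lintegral_mono fun x ↦ ?_
          rw [← ofReal_norm]
          exact ENNReal.ofReal_le_ofReal (norm_inner_le_norm _ _)
  set M := (m Set.univ).toReal with hM
  have hM0 : 0 < M := ENNReal.toReal_pos (by simpa using hm) (measure_ne_top _ _)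
  have hmM : m Set.univ = ENNReal.ofReal M := (ENNReal.ofReal_toReal (measure_ne_top _ _)).symm
  set B := ∫ x, ‖ψ x‖ ^ 2 / coulomb m x with hBdef
  have hB0 : 0 ≤ B := integral_nonneg fun x ↦ by unfold coulomb; positivity
  have hc : 0 < 12 * π * M := by positivity
  have main : ENNReal.ofReal (2 * J) ≤ ENNReal.ofReal (J + 12 * π * M * B) := by
    calc ENNReal.ofReal (2 * J) = 2 * ENNReal.ofReal J := by
          rw [ENNReal.ofReal_mul (by norm_num)]
          norm_num
      _ ≤ ∫⁻ x, 2 * ENNReal.ofReal (‖ψ x‖ * ‖𝓕⁻ w x‖) := by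
          rw [lintegral_const_mul' _ _ (by norm_num)]
          gcongr
      _ ≤ ∫⁻ x, (ENNReal.ofReal (12 * π * M)⁻¹ *
            ((∫⁻ y, ENNReal.ofReal ‖x - y‖⁻¹ ∂m) * ENNReal.ofReal (‖𝓕⁻ w x‖ ^ 2)) +
            ENNReal.ofReal (12 * π * M) * ENNReal.ofReal (‖ψ x‖ ^ 2 / coulomb m x)) := by
          refine lintegral_mono_ae ?_
          filter_upwards [ae_ae_ne m] with x hx
          refine two_mul_ofReal_mul_le (fun h0 ↦ hm ?_) (norm_nonneg _) hc
          rw [lintegral_eq_zero_iff (by fun_prop)] at h0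
          rw [← ae_eq_bot, ← Filter.eventually_false_iff_eq_bot]
          filter_upwards [hx, h0] with y hy h0
          simp [sub_eq_zero, hy] at h0
      _ = ENNReal.ofReal (12 * π * M)⁻¹ *
            (∫⁻ x, (∫⁻ y, ENNReal.ofReal ‖x - y‖⁻¹ ∂m) * ENNReal.ofReal (‖𝓕⁻ w x‖ ^ 2)) +
            ENNReal.ofReal (12 * π * M) * ENNReal.ofReal B := by
          rw [lintegral_add_right', lintegral_const_mul' _ _ ENNReal.ofReal_ne_top,
            lintegral_const_mul' _ _ ENNReal.ofReal_ne_top, hBdef,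
            ofReal_integral_eq_lintegral_ofReal hB]
          · exact .of_forall fun x ↦ by unfold coulomb; positivity
          · exact hB.aestronglyMeasurable.aemeasurable.ennreal_ofReal.const_mul _
      _ ≤ ENNReal.ofReal (12 * π * M)⁻¹ *
            (ENNReal.ofReal (12 * π) * ENNReal.ofReal J * ENNReal.ofReal M) +
            ENNReal.ofReal (12 * π * M) * ENNReal.ofReal B := by
          gcongr
          rw [← hwJ, ← hmM]
          exact lintegral_coulomb_mul_norm_fourierInv_sq_le m hw
      _ = _ := by
          rw [← ENNReal.ofReal_mul (by positivity), ← ENNReal.ofReal_mul (by positivity),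
            ← ENNReal.ofReal_mul (by positivity), ← ENNReal.ofReal_mul (by positivity),
            ← ENNReal.ofReal_add (by positivity) (by positivity)]
          congr 2
          field_simp
  rw [ENNReal.ofReal_le_ofReal_iff (by positivity)] at main
  have hMB : 0 ≤ M * B := by positivity
  have h1 : 2 * π * (2 * π * ∫ ξ, ‖ξ‖ * ‖𝓕 φ ξ‖ ^ 2) ≤ 2 * π * (6 * (M * B)) := by
    rw [hJdef] at main
    linarith
  linarith [le_of_mul_le_mul_left h1 (by positivity)]
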